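/- Let G be a group with finite symmetric generating set S acting by isometries on a δ-hyperbolic geodesic metric space Y with basepoint p. Then there are constants K ≥ 0 and C₁ > 0 depending only on δ, such that for every M > 0, every g ∈ G, and every geodesic γ from p to g(p) of length N > 1: if γ is not (K, M·log N) well-matched, then there is a quasimorphism φ on G with D(φ) ≤ C₁ and φ(g) ≥ N/(100·M·log N). -/

import Mathlib

/-!
STATEMENT 16 (Lemma `no_matching_quasimorphism`): there are `K` and `C₁` depending only on
`δ` so that if a geodesic `γ` from `p` to `g(p)` of length `N > 1` is not
`(K, M·log N)` well-matched, then there is a quasimorphism `φ` on `G` with `D(φ) ≤ C₁` and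
`φ(g) ≥ N/(100·M·log N)`.
-/

universe u v

open scoped Classical

namespace SclPaper

section MetricDefs

variable {Y : Type*} [MetricSpace Y]

/-- `γ` restricted to `[a,b]` is a unit-speed geodesic. -/
def IsGeodesicOn (γ : ℝ → Y) (a b : ℝ) : Prop :=
  ∀ s ∈ Set.Icc a b, ∀ t ∈ Set.Icc a b, dist (γ s) (γ t) = |s - t|

/-- `γ` is a unit-speed geodesic from `x` to `y`, parameterized on `[0, dist x y]`. -/
def GeodesicFromTo (γ : ℝ → Y) (x y : Y) : Prop :=
  γ 0 = x ∧ γ (dist x y) = y ∧ IsGeodesicOn γ 0 (dist x y)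

/-- A geodesic metric space: any two points are joined by a geodesic. -/
def GeodesicSpace (Y : Type*) [MetricSpace Y] : Prop :=
  ∀ x y : Y, ∃ γ : ℝ → Y, GeodesicFromTo γ x y

/-- `Y` is `δ`-hyperbolic: geodesic triangles are `δ`-thin (each side is contained in the
`δ`-neighborhood of the union of the other two sides). -/
def GromovHyperbolic (Y : Type*) [MetricSpace Y] (δ : ℝ) : Prop :=
  ∀ (x y z : Y) (γ₁ γ₂ γ₃ : ℝ → Y),
    GeodesicFromTo γ₁ x y → GeodesicFromTo γ₂ y z → GeodesicFromTo γ₃ z x →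
    ∀ s ∈ Set.Icc (0 : ℝ) (dist x y),
      (∃ t ∈ Set.Icc (0 : ℝ) (dist y z), dist (γ₁ s) (γ₂ t) ≤ δ) ∨
      (∃ t ∈ Set.Icc (0 : ℝ) (dist z x), dist (γ₁ s) (γ₃ t) ≤ δ)

end MetricDefs

/-- `φ` is a quasimorphism with defect at most `D`. -/
def QuasimorphismWithDefect {G : Type*} [Group G] (φ : G → ℝ) (D : ℝ) : Prop :=
  ∀ a b : G, |φ (a * b) - φ a - φ b| ≤ D

/-- `(γ|[a₁,a₁+R], γ|[a₂,a₂+R], h)` is an `R`-match (with respect to `K`) for some `h`: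
a triple of subsegments of `γ` of length `R` which are anti-aligned by `h` up to error
`K`. -/
def Matched (G : Type*) [Group G] {Y : Type*} [MetricSpace Y] [MulAction G Y]
    (K : ℝ) (γ : ℝ → Y) (a₁ a₂ R : ℝ) : Prop :=
  ∃ h : G, dist (h • γ a₁) (γ (a₂ + R)) ≤ K ∧ dist (h • γ (a₁ + R)) (γ a₂) ≤ K

/-- The geodesic `γ` (parameterized on `[0,N]`) is `(K, T)` well-matched, where the
`α i = γ|[iT,(i+1)T]` are the successive nonoverlapping subsegments of `γ` of length `T`:
for every subset `I` of the indices with `|I| > N/(10T)` there are at least `9|I|/10`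
pairwise disjoint subsegments `β j` of `γ` of length `T`, elements `h j ∈ G` and indices
`idx j ∈ I` so that each `(α (idx j), β j, h j)` is a match. -/
def WellMatched (G : Type*) [Group G] {Y : Type*} [MetricSpace Y] [MulAction G Y]
    (K : ℝ) (γ : ℝ → Y) (N T : ℝ) : Prop :=
  ∀ I : Finset ℕ, (∀ i ∈ I, ((i : ℝ) + 1) * T ≤ N) → N / (10 * T) < (I.card : ℝ) →
    ∃ m : ℕ, 9 * (I.card : ℝ) / 10 ≤ (m : ℝ) ∧
      ∃ (β : Fin m → ℝ) (idx : Fin m → ℕ),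
        (∀ j, idx j ∈ I) ∧
        (∀ j, 0 ≤ β j ∧ β j + T ≤ N) ∧
        (∀ j j', j ≠ j' → β j + T ≤ β j' ∨ β j' + T ≤ β j) ∧
        (∀ j, Matched G K γ ((idx j : ℝ) * T) (β j) T)


section Helpers

variable {Y : Type*} [MetricSpace Y]

lemma geod_rev {γ : ℝ → Y} {x y : Y} (h : GeodesicFromTo γ x y) :
    GeodesicFromTo (fun t => γ (dist x y - t)) y x := by
  obtain ⟨h0, h1, h2⟩ := h
  refine ⟨by simpa using h1, by simp [dist_comm y x, h0], ?_⟩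
  intro s hs t ht
  rw [dist_comm y x] at hs ht
  rw [h2 _ ⟨by linarith [hs.2], by linarith [hs.1]⟩ _ ⟨by linarith [ht.2], by linarith [ht.1]⟩]
  rw [abs_sub_comm]
  congr 1
  ring

lemma geod_dist_left {γ : ℝ → Y} {x y : Y} (h : GeodesicFromTo γ x y) {s : ℝ}
    (hs : s ∈ Set.Icc (0 : ℝ) (dist x y)) : dist x (γ s) = s := by
  obtain ⟨h0, h1, h2⟩ := h
  have := h2 0 ⟨le_refl _, dist_nonneg⟩ s hs
  rw [h0] at this
  rw [this, zero_sub, abs_neg, abs_of_nonneg hs.1]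

lemma geod_dist_right {γ : ℝ → Y} {x y : Y} (h : GeodesicFromTo γ x y) {s : ℝ}
    (hs : s ∈ Set.Icc (0 : ℝ) (dist x y)) : dist (γ s) y = dist x y - s := by
  obtain ⟨h0, h1, h2⟩ := h
  have := h2 s hs (dist x y) ⟨dist_nonneg, le_refl _⟩
  rw [h1] at this
  rw [this, abs_sub_comm, abs_of_nonneg (by linarith [hs.2])]

/-- slimness in the form of approximate betweenness -/
lemma slim_between {δ : ℝ} (hg : GeodesicSpace Y) (hh : GromovHyperbolic Y δ)
    {x z : Y} (y : Y) {γ : ℝ → Y} (h : GeodesicFromTo γ x z) {s : ℝ}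
    (hs : s ∈ Set.Icc (0 : ℝ) (dist x z)) :
    dist x (γ s) + dist (γ s) y ≤ dist x y + 2 * δ ∨
    dist z (γ s) + dist (γ s) y ≤ dist z y + 2 * δ := by
  obtain ⟨γ₂, h₂⟩ := hg z y
  obtain ⟨γ₃, h₃⟩ := hg y x
  rcases hh x z y γ γ₂ γ₃ h h₂ h₃ s hs with ⟨t, ht, hd⟩ | ⟨t, ht, hd⟩
  · right
    have e1 := geod_dist_left h₂ ht
    have e2 := geod_dist_right h₂ ht
    have t1 := dist_triangle z (γ₂ t) (γ s)
    have t2 := dist_triangle (γ s) (γ₂ t) y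
    rw [dist_comm (γ₂ t) (γ s)] at t1
    linarith
  · left
    have e1 := geod_dist_left h₃ ht
    have e2 := geod_dist_right h₃ ht
    have t1 := dist_triangle x (γ₃ t) (γ s)
    have t2 := dist_triangle (γ s) (γ₃ t) y
    rw [dist_comm (γ₃ t) (γ s), dist_comm x (γ₃ t)] at t1
    rw [dist_comm (γ₃ t) y] at t2
    rw [dist_comm x y]
    linarith

/-- four-point condition -/
def Four (Y : Type*) [MetricSpace Y] (D : ℝ) : Prop :=
  ∀ x y z w : Y, dist x z + dist y w ≤ dist x y + dist z w + D ∨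
    dist x z + dist y w ≤ dist x w + dist y z + D

def Pts (Y : Type*) [MetricSpace Y] : Prop :=
  ∀ (x z : Y) (s : ℝ), 0 ≤ s → s ≤ dist x z → ∃ y, dist x y = s ∧ dist y z = dist x z - s

lemma pts_of_geod (hg : GeodesicSpace Y) : Pts Y := by
  intro x z s h0 h1
  obtain ⟨γ, h⟩ := hg x z
  exact ⟨γ s, geod_dist_left h ⟨h0, h1⟩, geod_dist_right h ⟨h0, h1⟩⟩

lemma four_of_hyp {δ : ℝ} (hδ : 0 ≤ δ) (hg : GeodesicSpace Y) (hh : GromovHyperbolic Y δ) :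
    Four Y (4 * δ) := by
  intro x y z w
  obtain ⟨γ, h⟩ := hg x z
  have hcont : ContinuousOn γ (Set.Icc (0 : ℝ) (dist x z)) := by
    have : LipschitzOnWith 1 γ (Set.Icc (0 : ℝ) (dist x z)) := by
      apply LipschitzOnWith.of_dist_le_mul
      intro s hs t ht
      rw [h.2.2 s hs t ht]
      simp [Real.dist_eq]
    exact this.continuousOn
  have hmid : ∃ s ∈ Set.Icc (0 : ℝ) (dist x z),
      dist x (γ s) + dist (γ s) y ≤ dist x y + 2 * δ ∧
      dist z (γ s) + dist (γ s) y ≤ dist z y + 2 * δ := by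
    have hpc : IsPreconnected (Set.Icc (0 : ℝ) (dist x z)) := isPreconnected_Icc
    have hc : IsPreconnected (γ '' (Set.Icc (0 : ℝ) (dist x z))) := hpc.image _ hcont
    rw [isPreconnected_closed_iff] at hc
    have := hc {m | dist x m + dist m y ≤ dist x y + 2 * δ}
      {m | dist z m + dist m y ≤ dist z y + 2 * δ}
      (isClosed_le (by fun_prop) (by fun_prop)) (isClosed_le (by fun_prop) (by fun_prop))
      (by
        rintro _ ⟨s, hs, rfl⟩
        exact slim_between hg hh y h hs)
      ⟨x, ⟨0, ⟨le_refl _, dist_nonneg⟩, h.1⟩, by simp [hδ]⟩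
      ⟨z, ⟨dist x z, ⟨dist_nonneg, le_refl _⟩, h.2.1⟩, by simp [hδ]⟩
    obtain ⟨_, ⟨s, hs, rfl⟩, h1, h2⟩ := this
    exact ⟨s, hs, h1, h2⟩
  obtain ⟨s, hs, h1, h2⟩ := hmid
  have e1 := geod_dist_left h hs
  have e2 := geod_dist_right h hs
  have t := dist_triangle y (γ s) w
  have c1 := dist_comm (γ s) y
  have c2 := dist_comm (γ s) z
  have c3 := dist_comm y z
  have c4 := dist_comm z w
  rcases slim_between hg hh w h hs with h3 | h3
  · right; linarith
  · left; linarith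

/-- abstract properties of the cost function -/
structure GoodF (F : Y → Y → ℝ) : Prop where
  le : ∀ x y, F x y ≤ dist x y
  ge : ∀ x y, 99 / 100 * dist x y ≤ F x y
  tri : ∀ x y z, F x z ≤ F x y + F y z
  cross : ∀ (x z : Y) (A : Set Y), x ∈ A → z ∉ A →
    ∃ u ∈ A, ∃ v, v ∉ A ∧ F x u + dist u v + F v z ≤ F x z + 2

lemma GoodF.self {F : Y → Y → ℝ} (hF : GoodF F) (x : Y) : F x x = 0 := by
  have h1 := hF.le x x
  have h2 := hF.ge x x
  simp at h1 h2
  linarith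

lemma GoodF.rev {F : Y → Y → ℝ} (hF : GoodF F) : GoodF (fun x y => F y x) where
  le x y := by rw [dist_comm]; exact hF.le y x
  ge x y := by rw [dist_comm]; exact hF.ge y x
  tri x y z := by linarith [hF.tri z y x]
  cross x z A hx hz := by
    obtain ⟨u, hu, v, hv, h⟩ := hF.cross z x Aᶜ hz (by simpa using hx)
    refine ⟨v, by simpa using hv, u, hu, ?_⟩
    rw [dist_comm v u]
    linarith

/-- quasi-additivity along geodesics -/
def QAdd (F : Y → Y → ℝ) (D B l : ℝ) : Prop :=
  ∀ x y z, dist x y + dist y z ≤ dist x z + D → F x y + F y z ≤ F x z + B + l * dist x z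

lemma QAdd.rev {F : Y → Y → ℝ} {D B l : ℝ} (h : QAdd F D B l) :
    QAdd (fun x y => F y x) D B l := by
  intro x y z hxyz
  have := h z y x (by rw [dist_comm z y, dist_comm y x, dist_comm z x]; linarith)
  rw [dist_comm z x] at this
  show F y x + F z y ≤ F z x + B + l * dist x z
  linarith

/-- `o` is the center on `[x,z]` of the triangle `x,u,z`. -/
lemma center {D : ℝ} (h4 : Four Y D) {x u z o : Y}
    (h1 : dist x o = (dist x z + dist x u - dist u z) / 2)
    (h2 : dist o z = (dist x z + dist u z - dist x u) / 2) :
    dist x o + dist o u ≤ dist x u + D ∧ dist u o + dist o z ≤ dist u z + D := by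
  have c1 := dist_comm o u
  have c2 := dist_comm o z
  rcases h4 x u z o with h | h <;> constructor <;> linarith [dist_comm u z]

/-- points nearly on an optimal chain are close to the geodesic -/
lemma claimW {F : Y → Y → ℝ} {D B l : ℝ} (h4 : Four Y D) (hF : GoodF F)
    (hB : 0 ≤ B) (hl : 0 ≤ l) (hl1 : l ≤ 1 / 100)
    (hq : QAdd F D B l) {x u z o : Y}
    (h1 : dist x o = (dist x z + dist x u - dist u z) / 2)
    (h2 : dist o z = (dist x z + dist u z - dist x u) / 2)
    (hu : F x u + F u z ≤ F x z + 2) :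
    dist o u ≤ 2 + 2 * B + 2 * (l * dist x z) := by
  obtain ⟨b1, b2⟩ := center h4 h1 h2
  have q1 := hq x o u b1
  have q2 := hq u o z b2
  have t := hF.tri x o z
  have g1 := hF.ge o u
  have g2 := hF.ge u o
  rw [dist_comm u o] at g2
  have g3 := hF.ge x u
  have g4 := hF.ge u z
  have g5 := hF.le x z
  have hd : (0:ℝ) ≤ dist x z := dist_nonneg
  have m : l * (dist x u + dist u z) ≤ l * (2 * dist x z + 4) :=
    mul_le_mul_of_nonneg_left (by linarith) hl
  have hld : 0 ≤ l * dist x z := mul_nonneg hl hd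
  nlinarith

lemma exists_center (hp : Pts Y) (x u z : Y) : ∃ o,
    dist x o = (dist x z + dist x u - dist u z) / 2 ∧
    dist o z = (dist x z + dist u z - dist x u) / 2 := by
  obtain ⟨o, h1, h2⟩ := hp x z ((dist x z + dist x u - dist u z) / 2)
    (by linarith [dist_triangle u x z, dist_comm u x])
    (by linarith [dist_triangle x z u, dist_comm u z])
  exact ⟨o, h1, by rw [h2]; ring⟩

lemma cross_point {F : Y → Y → ℝ} {D B l : ℝ} (hD : 0 ≤ D) (hp : Pts Y) (h4 : Four Y D)
    (hF : GoodF F) (hB : 0 ≤ B) (hl : 0 ≤ l) (hl1 : l ≤ 1 / 100)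
    (hq : QAdd F D B l) {x y z : Y} (hy : dist x y + dist y z = dist x z) :
    ∃ w, F x w + F w z ≤ F x z + 2 ∧
      dist w y ≤ 2 * (2 + 2 * B + 2 * (l * dist x z)) + 3 * D := by
  have hr : 0 ≤ l * dist x z := mul_nonneg hl dist_nonneg
  by_cases hyz : y = z
  · subst hyz
    refine ⟨y, by rw [hF.self]; linarith, ?_⟩
    rw [dist_self]; linarith
  have hpos : 0 < dist y z := dist_pos.2 hyz
  obtain ⟨u, hu, v, hv, huv⟩ := hF.cross x z {u | dist x u - dist u z ≤ dist x y - dist y z}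
    (by simp; linarith [dist_nonneg (x := x) (y := y)]) (by simp; linarith)
  simp only [Set.mem_ofPred_eq, not_le] at hu hv
  obtain ⟨o, o1, o2⟩ := exists_center hp x u z
  have hou := claimW h4 hF hB hl hl1 hq o1 o2
    (by linarith [hF.tri u v z, hF.le u v])
  have key : dist u y + dist y v ≤ dist u v + 2 * (2 + 2 * B + 2 * (l * dist x z)) + 2 * D := by
    have a1 : dist u y ≤ dist x y + dist u z - dist x z + D := by
      rcases h4 x u z y with h | h <;> linarith [dist_comm y z]
    have a2 : dist y v ≤ dist y z + dist x v - dist x z + D := by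
      rcases h4 x v z y with h | h <;> linarith [dist_comm y z, dist_comm v y]
    have t1 := dist_triangle x u v
    have t2 := dist_triangle x o u
    have t3 := dist_triangle u o z
    linarith [dist_comm u o]
  have main : ∃ w, dist u w + dist w v = dist u v ∧
      dist w y ≤ 2 * (2 + 2 * B + 2 * (l * dist x z)) + 3 * D := by
    by_cases hc : dist u y ≤ dist u v
    · obtain ⟨w, w1, w2⟩ := hp u v (dist u y) dist_nonneg hc
      refine ⟨w, by linarith, ?_⟩
      rcases h4 u w v y with h | h <;> linarith [dist_comm v y]
    · refine ⟨v, by simp, ?_⟩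
      push Not at hc
      linarith [dist_comm v y]
  obtain ⟨w, w1, w2⟩ := main
  refine ⟨w, ?_, w2⟩
  linarith [hF.tri x u w, hF.tri w v z, hF.le u w, hF.le w v]

lemma left_point {F : Y → Y → ℝ} {D B l : ℝ} (hD : 0 ≤ D) (hp : Pts Y) (h4 : Four Y D)
    (hF : GoodF F) (hB : 0 ≤ B) (hl : 0 ≤ l) (hl1 : l ≤ 1 / 100)
    (hq : QAdd F D B l) {x y z : Y} (hy : dist x y + dist y z = dist x z) :
    ∃ w, F x w + F w z ≤ F x z + 2 ∧ dist w y + dist y z ≤ dist w z + D ∧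
      dist w y ≤ 4 * (2 + 2 * B + 2 * (l * dist x z)) + 7 * D + 1 ∧
      dist w z ≤ dist x z + 2 * (2 + 2 * B + 2 * (l * dist x z)) + 3 * D := by
  have hr : 0 ≤ l * dist x z := mul_nonneg hl dist_nonneg
  by_cases hc : dist x y ≤ 2 * (2 + 2 * B + 2 * (l * dist x z)) + 4 * D + 1
  · refine ⟨x, by rw [hF.self]; linarith, by linarith, by linarith, by linarith⟩
  push Not at hc
  obtain ⟨y', e1, e2⟩ := hp y x (2 * (2 + 2 * B + 2 * (l * dist x z)) + 4 * D + 1)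
    (by linarith) (by linarith [dist_comm x y])
  have hy' : dist x y' + dist y' z = dist x z := by
    linarith [dist_triangle x y' z, dist_triangle y' y z, dist_comm x y', dist_comm y y',
      dist_comm x y]
  have hy'z : dist y' z = dist y' y + dist y z := by
    linarith [dist_triangle x y' z, dist_triangle y' y z, dist_comm x y', dist_comm y y',
      dist_comm x y]
  obtain ⟨w, w1, w2⟩ := cross_point hD hp h4 hF hB hl hl1 hq hy'
  refine ⟨w, w1, ?_, ?_, ?_⟩
  · rcases h4 w y' y z with h | h
    · linarith [dist_triangle y' w y, dist_comm y' y, dist_comm y' w]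
    · linarith [dist_comm y' y]
  · linarith [dist_triangle w y' y, dist_comm y' y]
  · linarith [dist_triangle w y' z, dist_nonneg (x := x) (y := y')]

lemma near_exact {D : ℝ} (hD : 0 ≤ D) (hp : Pts Y) (h4 : Four Y D) {x y z : Y}
    (h : dist x y + dist y z ≤ dist x z + D) :
    ∃ y', dist x y' + dist y' z = dist x z ∧ dist y y' ≤ 2 * D := by
  by_cases hc : dist x y ≤ dist x z
  · obtain ⟨w, w1, w2⟩ := hp x z (dist x y) dist_nonneg hc
    refine ⟨w, by linarith, ?_⟩
    rcases h4 x y z w with h | h <;> linarith [dist_comm w z]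
  · exact ⟨z, by simp, by linarith⟩

lemma improve {F : Y → Y → ℝ} {D l : ℝ} (hD : 0 ≤ D) (hp : Pts Y) (h4 : Four Y D)
    (hF : GoodF F) (hl : 0 ≤ l) (hl1 : l ≤ 1 / 100)
    (hq : QAdd F D (10 + 20 * D) l) : QAdd F D (10 + 20 * D) (l / 2) := by
  intro x y0 z hy0
  have hB : 0 ≤ 10 + 20 * D := by linarith
  have hr : 0 ≤ l * dist x z := mul_nonneg hl dist_nonneg
  obtain ⟨y, hy, hyy⟩ := near_exact hD hp h4 hy0
  obtain ⟨w, w1, w2, w3, w4⟩ := left_point hD hp h4 hF hB hl hl1 hq hy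
  obtain ⟨y1, hy1, hyy1⟩ := near_exact hD hp h4 w2
  obtain ⟨v, v1, v2, v3, v4⟩ := left_point hD hp h4 hF.rev hB hl hl1 hq.rev
    (x := z) (y := y1) (z := w) (by linarith [dist_comm z y1, dist_comm y1 w, dist_comm w z])
  have m : l * dist z w ≤ l * (dist x z + 2 * (2 + 2 * (10 + 20 * D) + 2 * (l * dist x z)) + 3 * D) :=
    mul_le_mul_of_nonneg_left (by rw [dist_comm]; exact w4) hl
  have m2 : l * (2 * (2 + 2 * (10 + 20 * D) + 2 * (l * dist x z)) + 3 * D) ≤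
      1 / 100 * (2 * (2 + 2 * (10 + 20 * D) + 2 * (l * dist x z)) + 3 * D) :=
    mul_le_mul_of_nonneg_right hl1 (by linarith)
  have m3 : l * dist z w ≤ l * dist x z +
      1 / 100 * (2 * (2 + 2 * (10 + 20 * D) + 2 * (l * dist x z)) + 3 * D) := by
    rw [add_assoc, mul_add] at m
    linarith
  have g := hF.ge w v
  have t1 := dist_triangle w y1 v
  have t2 := dist_triangle w y y1
  have f1 := hF.tri x w y0
  have f2 := hF.tri w y1 y0
  have f3 := hF.tri y0 y1 z
  have f4 := hF.tri y1 v z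
  have f5 := hF.le w y1
  have f6 := hF.le y1 v
  have f7 := hF.le y1 y0
  have f8 := hF.le y0 y1
  have t3 := dist_triangle y0 y y1
  have := dist_comm y0 y1
  have := dist_comm y1 v
  have := dist_comm y1 w
  have := dist_comm v w
  linarith

lemma qadd_all {F : Y → Y → ℝ} {D : ℝ} (hD : 0 ≤ D) (hp : Pts Y) (h4 : Four Y D)
    (hF : GoodF F) : ∀ x y z, dist x y + dist y z ≤ dist x z + D →
      F x y + F y z ≤ F x z + (10 + 20 * D) := by
  have hn : ∀ n : ℕ, QAdd F D (10 + 20 * D) ((1 / 100) * (1 / 2) ^ n) := by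
    intro n
    induction n with
    | zero =>
      intro x y z h
      have := hF.ge x z
      have := hF.le x y
      have := hF.le y z
      norm_num
      linarith
    | succ n ih =>
      have := improve hD hp h4 hF (by positivity) (by
        have : ((1:ℝ) / 2) ^ n ≤ 1 := pow_le_one₀ (by norm_num) (by norm_num)
        linarith) ih
      rw [pow_succ]
      convert this using 1
      ring
  intro x y z h
  have hlim : Filter.Tendsto (fun n : ℕ => F x z + (10 + 20 * D) +
      ((1 / 100) * (1 / 2 : ℝ) ^ n) * dist x z) Filter.atTop
      (nhds (F x z + (10 + 20 * D) + ((1 / 100) * 0) * dist x z)) := by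
    apply Filter.Tendsto.const_add
    apply Filter.Tendsto.mul_const
    apply Filter.Tendsto.const_mul
    exact tendsto_pow_atTop_nhds_zero_of_lt_one (by norm_num) (by norm_num)
  have := ge_of_tendsto' hlim (fun n => hn n x y z h)
  linarith

/-! ### chains -/

inductive Chain (R : Y → Y → Prop) (x : Y) : Y → ℕ → ℝ → Prop
  | nil : Chain R x x 0 0
  | step {y : Y} {k : ℕ} {c : ℝ} (z : Y) : Chain R x y k c → Chain R x z k (c + dist y z)
  | reward {y z : Y} {k : ℕ} {c : ℝ} : Chain R x y k c → R y z →
      Chain R x z (k + 1) (c + (dist y z - 1))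

noncomputable def chF (R : Y → Y → Prop) (x z : Y) : ℝ := sInf {c | ∃ k, Chain R x z k c}

lemma Chain.concat {R : Y → Y → Prop} {x y z : Y} {k k' : ℕ} {c c' : ℝ}
    (h : Chain R x y k c) (h' : Chain R y z k' c') : Chain R x z (k + k') (c + c') := by
  induction h' with
  | nil => simpa using h
  | step z h2 ih => rw [← add_assoc]; exact Chain.step z ih
  | reward h2 hr ih => rw [← add_assoc, ← add_assoc]; exact Chain.reward ih hr

lemma Chain.lower {R : Y → Y → Prop} (hR : ∀ u v, R u v → 100 ≤ dist u v) {x z : Y} {k : ℕ} {c : ℝ}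
    (h : Chain R x z k c) : 99 / 100 * dist x z ≤ c := by
  induction h with
  | nil => simp
  | @step y k c z h ih =>
    linarith [dist_triangle x y z, dist_nonneg (x := y) (y := z)]
  | @reward y z k c h hr ih =>
    linarith [dist_triangle x y z, hR _ _ hr]

lemma Chain.lower' {R : Y → Y → Prop} {x z : Y} {k : ℕ} {c : ℝ}
    (h : Chain R x z k c) : dist x z - k ≤ c := by
  induction h with
  | nil => simp
  | @step y k c z h ih =>
    linarith [dist_triangle x y z]
  | @reward y z k c h hr ih =>
    push_cast
    linarith [dist_triangle x y z]

lemma chain_dist (R : Y → Y → Prop) (x z : Y) : Chain R x z 0 (dist x z) := by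
  simpa using Chain.step (R := R) z Chain.nil


lemma chF_bdd {R : Y → Y → Prop} (hR : ∀ u v, R u v → 100 ≤ dist u v)
    (x z : Y) : BddBelow {c | ∃ k, Chain R x z k c} :=
  ⟨99 / 100 * dist x z, by rintro c ⟨k, h⟩; exact h.lower hR⟩

lemma chF_le {R : Y → Y → Prop} (hR : ∀ u v, R u v → 100 ≤ dist u v)
    {x z : Y} {k : ℕ} {c : ℝ} (h : Chain R x z k c) : chF R x z ≤ c :=
  csInf_le (chF_bdd hR x z) ⟨k, h⟩

lemma chF_near {R : Y → Y → Prop} (x z : Y) {e : ℝ} (he : 0 < e) :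
    ∃ k c, Chain R x z k c ∧ c ≤ chF R x z + e := by
  obtain ⟨c, ⟨k, h⟩, hc⟩ := Real.lt_sInf_add_pos (s := {c | ∃ k, Chain R x z k c})
    ⟨_, 0, chain_dist R x z⟩ he
  exact ⟨k, c, h, hc.le⟩

lemma chF_le_dist {R : Y → Y → Prop} (hR : ∀ u v, R u v → 100 ≤ dist u v)
    (x z : Y) : chF R x z ≤ dist x z := chF_le hR (chain_dist R x z)

lemma chF_tri {R : Y → Y → Prop} (hR : ∀ u v, R u v → 100 ≤ dist u v)
    (x y z : Y) : chF R x z ≤ chF R x y + chF R y z := by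
  apply le_of_forall_pos_le_add
  intro e he
  obtain ⟨k, c, h, hc⟩ := chF_near (R := R) x y (half_pos he)
  obtain ⟨k', c', h', hc'⟩ := chF_near (R := R) y z (half_pos he)
  have := chF_le hR (h.concat h')
  linarith

lemma chF_reward {R : Y → Y → Prop} (hR : ∀ u v, R u v → 100 ≤ dist u v)
    {x z : Y} (h : R x z) : chF R x z ≤ dist x z - 1 := by
  have := chF_le hR (Chain.reward Chain.nil h)
  linarith

lemma Chain.cross {R : Y → Y → Prop} {x z : Y} {k : ℕ} {c : ℝ} (h : Chain R x z k c)
    (hR : ∀ u v, R u v → 100 ≤ dist u v) (A : Set Y) (hx : x ∈ A)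
    (hz : z ∉ A) : ∃ u ∈ A, ∃ v, v ∉ A ∧ chF R x u + dist u v + chF R v z ≤ c + 1 := by
  induction h with
  | nil => exact absurd hx hz
  | @step y k c z h ih =>
    by_cases hy : y ∈ A
    · refine ⟨y, hy, z, hz, ?_⟩
      have h1 := chF_le hR h
      have h2 := chF_le_dist hR z z
      rw [dist_self] at h2
      linarith
    · obtain ⟨u, hu, v, hv, huv⟩ := ih hy
      refine ⟨u, hu, v, hv, ?_⟩
      linarith [chF_tri hR v y z, chF_le_dist hR y z]
  | @reward y z k c h hr ih =>
    by_cases hy : y ∈ A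
    · refine ⟨y, hy, z, hz, ?_⟩
      have h1 := chF_le hR h
      have h2 := chF_le_dist hR z z
      rw [dist_self] at h2
      linarith
    · obtain ⟨u, hu, v, hv, huv⟩ := ih hy
      refine ⟨u, hu, v, hv, ?_⟩
      linarith [chF_tri hR v y z, chF_reward hR hr]

lemma goodF_chF {R : Y → Y → Prop} (hR : ∀ u v, R u v → 100 ≤ dist u v)
    : GoodF (chF R) where
  le := chF_le_dist hR
  ge x z := by
    refine le_csInf (s := {c | ∃ k, Chain R x z k c}) ⟨_, 0, chain_dist R x z⟩ ?_
    rintro c ⟨k, h⟩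
    exact h.lower hR
  tri := chF_tri hR
  cross x z A hx hz := by
    obtain ⟨k, c, h, hc⟩ := chF_near (R := R) x z one_pos
    obtain ⟨u, hu, v, hv, huv⟩ := h.cross hR A hx hz
    exact ⟨u, hu, v, hv, by linarith⟩

/-- ordered list of the rewarded edges of a chain -/
lemma Chain.edges {R : Y → Y → Prop} {x z : Y} {k : ℕ} {c : ℝ} (h : Chain R x z k c)
    (hR : ∀ u v, R u v → 100 ≤ dist u v) :
    ∃ u v : ℕ → Y, (∀ j < k, R (u j) (v j) ∧
        chF R x (u j) + chF R (u j) (v j) + chF R (v j) z ≤ c) ∧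
      ∀ j j', j < j' → j' < k →
        chF R x (v j) + chF R (v j) (u j') + chF R (u j') z ≤ c := by
  induction h with
  | nil => exact ⟨fun _ => x, fun _ => x, by simp, by simp⟩
  | @step y k c z h ih =>
    obtain ⟨u, v, h1, h2⟩ := ih
    refine ⟨u, v, fun j hj => ⟨(h1 j hj).1, ?_⟩, fun j j' hj hj' => ?_⟩
    · linarith [(h1 j hj).2, chF_tri hR (v j) y z, chF_le_dist hR y z]
    · linarith [h2 j j' hj hj', chF_tri hR (u j') y z, chF_le_dist hR y z]
  | @reward y z k c h hr ih =>
    obtain ⟨u, v, h1, h2⟩ := ih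
    have hyz := chF_reward hR hr
    refine ⟨fun j => if j = k then y else u j, fun j => if j = k then z else v j, ?_, ?_⟩
    · intro j hj
      by_cases hjk : j = k
      · subst hjk
        simp only [if_true]
        refine ⟨hr, ?_⟩
        have h3 := chF_le hR h
        have h4 := chF_le_dist hR z z
        rw [dist_self] at h4
        linarith
      · simp only [hjk, if_false]
        have hj' : j < k := by omega
        refine ⟨(h1 j hj').1, ?_⟩
        linarith [(h1 j hj').2, chF_tri hR (v j) y z]
    · intro j j' hj hj'
      have hjk : j ≠ k := by omega
      by_cases hjk' : j' = k
      · simp only [hjk, hjk', if_false, if_true]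
        have := (h1 j (by omega)).2
        have := chF_tri hR x (u j) (v j)
        linarith
      · simp only [hjk, hjk', if_false]
        linarith [h2 j j' hj (by omega), chF_tri hR (u j') y z]

end Helpers

section Helpers2

variable {Y : Type*} [MetricSpace Y]

lemma defect_bound {F : Y → Y → ℝ} {D B : ℝ} (hD : 0 ≤ D) (hp : Pts Y) (h4 : Four Y D)
    (hF : GoodF F) (hq : ∀ x y z, dist x y + dist y z ≤ dist x z + D →
      F x y + F y z ≤ F x z + B) (x u z : Y) :
    |(F z x - F x z) - (F u x - F x u) - (F z u - F u z)| ≤ 6 * B := by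
  obtain ⟨o, o1, o2⟩ := exists_center hp x u z
  obtain ⟨b1, b2⟩ := center h4 o1 o2
  have := dist_comm x o
  have := dist_comm z o
  have := dist_comm u o
  have := dist_comm x z
  have := dist_comm u z
  have := dist_comm u x
  have q1 := hq x o z (by linarith)
  have q2 := hq z o x (by linarith)
  have q3 := hq x o u (by linarith)
  have q4 := hq u o x (by linarith)
  have q5 := hq u o z (by linarith)
  have q6 := hq z o u (by linarith)
  have t1 := hF.tri x o z
  have t2 := hF.tri z o x
  have t3 := hF.tri x o u
  have t4 := hF.tri u o x
  have t5 := hF.tri u o z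
  have t6 := hF.tri z o u
  rw [abs_le]
  constructor <;> linarith

lemma Chain.smul {G : Type*} [Group G] [MulAction G Y]
    (hiso : ∀ g : G, Isometry (fun y : Y => g • y)) {R : Y → Y → Prop}
    (hinv : ∀ (g : G) u v, R u v → R (g • u) (g • v)) (g : G) {x z : Y} {k : ℕ} {c : ℝ}
    (h : Chain R x z k c) : Chain R (g • x) (g • z) k c := by
  induction h with
  | nil => exact Chain.nil
  | @step y k c z h ih =>
    have := Chain.step (g • z) ih
    rwa [(hiso g).dist_eq y z] at this
  | @reward y z k c h hr ih =>
    have := Chain.reward ih (hinv g _ _ hr)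
    rwa [(hiso g).dist_eq y z] at this

lemma chF_smul {G : Type*} [Group G] [MulAction G Y]
    (hiso : ∀ g : G, Isometry (fun y : Y => g • y)) {R : Y → Y → Prop}
    (hinv : ∀ (g : G) u v, R u v → R (g • u) (g • v)) (g : G) (x z : Y) :
    chF R (g • x) (g • z) = chF R x z := by
  unfold chF
  congr 1
  ext c
  constructor
  · rintro ⟨k, h⟩
    have := h.smul hiso hinv g⁻¹
    rw [inv_smul_smul, inv_smul_smul] at this
    exact ⟨k, this⟩
  · rintro ⟨k, h⟩
    exact ⟨k, h.smul hiso hinv g⟩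

/-- position along `γ` of a point on a nearly optimal chain from `q` to `p` -/
lemma position {F : Y → Y → ℝ} {D B : ℝ} (h4 : Four Y D) (hF : GoodF F) (hB : 0 ≤ B)
    (hq : ∀ x y z, dist x y + dist y z ≤ dist x z + D → F x y + F y z ≤ F x z + B)
    {p q : Y} {γ : ℝ → Y} (hγ : GeodesicFromTo γ p q) {u : Y}
    (hu : F q u + F u p ≤ F q p + 1) :
    ∃ a ∈ Set.Icc (0 : ℝ) (dist p q), dist (γ a) u ≤ 2 + 2 * B := by
  have ha : (dist q p + dist u p - dist q u) / 2 ∈ Set.Icc (0 : ℝ) (dist p q) :=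
    ⟨by linarith [dist_triangle q p u, dist_comm p u],
      by linarith [dist_triangle u q p, dist_comm u q, dist_comm q p]⟩
  refine ⟨_, ha, ?_⟩
  have e1 := geod_dist_left hγ ha
  have e2 := geod_dist_right hγ ha
  have := claimW (l := 0) h4 hF hB le_rfl (by norm_num)
    (fun x y z h => by have := hq x y z h; linarith) (x := q) (u := u) (z := p)
    (o := γ ((dist q p + dist u p - dist q u) / 2))
    (by rw [dist_comm q (γ _), e2, dist_comm p q]; ring) (by rw [dist_comm (γ _) p, e1])
    (by linarith)
  linarith

lemma no_back {F : Y → Y → ℝ} {D B r : ℝ} (hD : 0 ≤ D) (hF : GoodF F) (hB : 0 ≤ B)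
    (hq : ∀ x y z, dist x y + dist y z ≤ dist x z + D → F x y + F y z ≤ F x z + B)
    {p q : Y} {γ : ℝ → Y} (hγ : GeodesicFromTo γ p q) {u v : Y} {a b : ℝ}
    (ha : a ∈ Set.Icc (0 : ℝ) (dist p q)) (hb : b ∈ Set.Icc (0 : ℝ) (dist p q))
    (hau : dist (γ a) u ≤ r) (hbv : dist (γ b) v ≤ r)
    (huv : F q u + F u v + F v p ≤ F q p + 1) : b ≤ a + (2 * B + 4 * r + 1) := by
  have hr : 0 ≤ r := le_trans dist_nonneg hau
  by_contra hcon
  push Not at hcon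
  have hab : a < b := by linarith
  have e1 := geod_dist_left hγ ha
  have e2 := geod_dist_right hγ ha
  have e3 := geod_dist_left hγ hb
  have e4 := geod_dist_right hγ hb
  have e5 := hγ.2.2 a ha b hb
  rw [abs_sub_comm, abs_of_nonneg (by linarith)] at e5
  have := dist_comm (γ a) (γ b)
  have := dist_comm (γ a) p
  have := dist_comm (γ b) p
  have := dist_comm (γ a) q
  have := dist_comm (γ b) q
  have q1 := hq q (γ b) (γ a) (by linarith)
  have q2 := hq (γ b) (γ a) p (by linarith)
  have t1 := hF.tri q u (γ a)
  have t2 := hF.tri (γ b) v p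
  have t3 := hF.tri (γ a) u (γ b)
  have t4 := hF.tri u v (γ b)
  have t5 := hF.tri q (γ b) p
  have t6 := hF.tri (γ b) (γ a) p
  have l1 := hF.le u (γ a)
  have l2 := hF.le (γ b) v
  have l3 := hF.le (γ a) u
  have l4 := hF.le v (γ b)
  have := dist_comm (γ a) u
  have := dist_comm (γ b) v
  have g1 := hF.ge (γ a) (γ b)
  have g2 := hF.ge (γ b) (γ a)
  linarith

lemma count_mod (k : ℕ) : ((Finset.range k).filter (fun j => j % 20 ≠ 19)).card + k / 20 = k := by
  induction k with
  | zero => simp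
  | succ k ih =>
    rw [Finset.range_add_one, Finset.filter_insert]
    split_ifs with h
    · rw [Finset.card_insert_of_notMem (by simp)]
      omega
    · omega

lemma spread {k : ℕ} {b : ℕ → ℝ} {c T N : ℝ} (hc : 0 ≤ c) (hT : 25 * c ≤ T)
    (h0 : ∀ j < k, 0 ≤ b j ∧ b j + T ≤ N + c)
    (h1 : ∀ j j', j < j' → j' < k → b j' + T - c ≤ b j) :
    ∃ (J : Finset ℕ) (β : ℕ → ℝ), (∀ j ∈ J, j < k) ∧ 19 * k ≤ 20 * J.card + 40 ∧
      (∀ j ∈ J, 0 ≤ β j ∧ β j + T ≤ N) ∧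
      (∀ j ∈ J, ∀ j' ∈ J, j ≠ j' → β j + T ≤ β j' ∨ β j' + T ≤ β j) ∧
      (∀ j, b j - 20 * c ≤ β j ∧ β j ≤ b j) := by
  have hm : ∀ j : ℕ, 0 ≤ ((j % 20 : ℕ) : ℝ) * c ∧ ((j % 20 : ℕ) : ℝ) * c ≤ 19 * c := by
    intro j
    refine ⟨by positivity, mul_le_mul_of_nonneg_right ?_ hc⟩
    have : j % 20 ≤ 19 := by omega
    exact_mod_cast this
  have key : ∀ j j', j < j' → j' < k → j % 20 ≠ 19 →
      (b j' - ((j' % 20 : ℕ) : ℝ) * c) + T ≤ b j - ((j % 20 : ℕ) : ℝ) * c := by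
    intro j j' hj hj' h19
    by_cases hrun : j / 20 = j' / 20
    · have hlt : (j % 20) + 1 ≤ j' % 20 := by omega
      have hlt' : (((j % 20 : ℕ) : ℝ) + 1) * c ≤ ((j' % 20 : ℕ) : ℝ) * c :=
        mul_le_mul_of_nonneg_right (by exact_mod_cast hlt) hc
      have := h1 j j' hj hj'
      linarith
    · have hd1 : j < j / 20 * 20 + 19 := by omega
      have hd2 : j / 20 * 20 + 19 < j' := by omega
      have a1 := h1 _ _ hd1 (by omega)
      have a2 := h1 _ _ hd2 hj'
      linarith [hm j, hm j']
  refine ⟨((Finset.range k).filter (fun j => j % 20 ≠ 19)) \ {0, k - 1},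
    fun j => b j - ((j % 20 : ℕ) : ℝ) * c, ?_, ?_, ?_, ?_, ?_⟩
  · intro j hj
    simp at hj
    exact hj.1.1
  · have e1 := Finset.le_card_sdiff ({0, k - 1} : Finset ℕ)
      ((Finset.range k).filter (fun j => j % 20 ≠ 19))
    have e2 := count_mod k
    have e3 : ({0, k - 1} : Finset ℕ).card ≤ 2 := Finset.card_le_two
    omega
  · intro j hj
    simp at hj
    obtain ⟨⟨hjk, h19⟩, hj0, hjk'⟩ := hj
    have a1 := h1 j (k - 1) (by omega) (by omega)
    have a2 := (h0 (k - 1) (by omega)).1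
    have a3 := h1 0 j (by omega) hjk
    have a4 := (h0 0 (by omega)).2
    constructor <;> linarith [hm j]
  · intro j hj j' hj' hne
    simp at hj hj'
    rcases lt_or_gt_of_ne hne with h | h
    · right; exact key j j' h hj'.1.1 hj.1.2
    · left; exact key j' j h hj.1.1 hj'.1.2
  · intro j
    constructor <;> linarith [hm j]

lemma upper_count {F : Y → Y → ℝ} (hF : GoodF F) {γ : ℝ → Y} {N T : ℝ} (hN : 0 ≤ N)
    (hT : 0 < T) (hγ : IsGeodesicOn γ 0 N) (I : Finset ℕ)
    (hI : ∀ i ∈ I, ((i : ℝ) + 1) * T ≤ N)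
    (hrew : ∀ i ∈ I, F (γ (i * T)) (γ (i * T + T)) ≤ T - 1) :
    F (γ 0) (γ N) ≤ N - I.card := by
  have hn : ∀ n : ℕ, (n : ℝ) * T ≤ N →
      F (γ 0) (γ (n * T)) ≤ n * T - (I.filter (fun i => i < n)).card := by
    intro n
    induction n with
    | zero => intro _; simp [hF.self]
    | succ n ih =>
      intro hnN
      push_cast at hnN ⊢
      have hn0 : 0 ≤ (n : ℝ) * T := by positivity
      have h1 := ih (by linarith)
      have t := hF.tri (γ 0) (γ (n * T)) (γ ((n + 1) * T))
      have hd := hγ (n * T) ⟨hn0, by linarith⟩ ((n + 1) * T) ⟨by linarith, hnN⟩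
      have hl := hF.le (γ (n * T)) (γ ((n + 1) * T))
      rw [hd, abs_sub_comm, abs_of_nonneg (by linarith)] at hl
      by_cases hmem : n ∈ I
      · have hr := hrew n hmem
        have e : I.filter (fun i => i < n + 1) = insert n (I.filter (fun i => i < n)) := by
          ext i
          simp only [Finset.mem_filter, Finset.mem_insert]
          constructor
          · rintro ⟨h, h'⟩
            rcases Nat.lt_succ_iff_lt_or_eq.1 h' with h'' | h''
            · exact Or.inr ⟨h, h''⟩
            · exact Or.inl h''
          · rintro (h | ⟨h, h'⟩)
            · subst h; exact ⟨hmem, by omega⟩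
            · exact ⟨h, by omega⟩
        rw [e, Finset.card_insert_of_notMem (by simp)]
        push_cast
        rw [show ((n : ℝ) + 1) * T = n * T + T by ring] at *
        linarith
      · have e : I.filter (fun i => i < n + 1) = I.filter (fun i => i < n) := by
          ext i
          simp only [Finset.mem_filter]
          constructor
          · rintro ⟨h, h'⟩
            have : i ≠ n := fun h'' => hmem (h'' ▸ h)
            exact ⟨h, by omega⟩
          · rintro ⟨h, h'⟩
            exact ⟨h, by omega⟩
        rw [e]
        linarith
  have hfl : ((⌊N / T⌋₊ : ℕ) : ℝ) * T ≤ N := by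
    have := Nat.floor_le (a := N / T) (by positivity)
    rwa [le_div_iff₀ hT] at this
  have h1 := hn _ hfl
  have e : I.filter (fun i => i < ⌊N / T⌋₊) = I := by
    apply Finset.filter_true_of_mem
    intro i hi
    have : i + 1 ≤ ⌊N / T⌋₊ := by
      apply Nat.le_floor
      rw [le_div_iff₀ hT]
      push_cast
      exact hI i hi
    omega
  rw [e] at h1
  have t := hF.tri (γ 0) (γ ((⌊N / T⌋₊ : ℕ) * T)) (γ N)
  have hd := hγ ((⌊N / T⌋₊ : ℕ) * T) ⟨by positivity, hfl⟩ N ⟨hN, le_rfl⟩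
  have hl := hF.le (γ ((⌊N / T⌋₊ : ℕ) * T)) (γ N)
  rw [hd, abs_sub_comm, abs_of_nonneg (by linarith)] at hl
  linarith

lemma wellMatched_small {G : Type*} [Group G] [MulAction G Y] {γ : ℝ → Y} {N T K : ℝ}
    (hT : 0 < T) (hTK : T ≤ K) (hγ : IsGeodesicOn γ 0 N) : WellMatched G K γ N T := by
  intro I hI _
  refine ⟨I.card, by linarith [Nat.cast_nonneg (α := ℝ) I.card],
    fun j => ((I.equivFin.symm j : ℕ) : ℝ) * T, fun j => (I.equivFin.symm j : ℕ),
    fun j => (I.equivFin.symm j).2, ?_, ?_, ?_⟩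
  · intro j
    have := hI _ (I.equivFin.symm j).2
    exact ⟨by positivity, by linarith⟩
  · intro j j' hne
    have hne' : (I.equivFin.symm j : ℕ) ≠ (I.equivFin.symm j' : ℕ) := by
      intro h
      exact hne (I.equivFin.symm.injective (Subtype.ext h))
    have mul : ∀ m n : ℕ, m < n → (m : ℝ) * T + T ≤ n * T := by
      intro m n h
      have : ((m : ℝ) + 1) * T ≤ n * T :=
        mul_le_mul_of_nonneg_right (by exact_mod_cast h) hT.le
      linarith
    rcases lt_or_gt_of_ne hne' with h | h
    · exact Or.inl (mul _ _ h)
    · exact Or.inr (mul _ _ h)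
  · intro j
    have h1 := hI _ (I.equivFin.symm j).2
    have h2 : 0 ≤ ((I.equivFin.symm j : ℕ) : ℝ) * T := by positivity
    have hd := hγ (((I.equivFin.symm j : ℕ) : ℝ) * T) ⟨h2, by linarith⟩
      (((I.equivFin.symm j : ℕ) : ℝ) * T + T) ⟨by linarith, by linarith⟩
    have he : dist (γ (((I.equivFin.symm j : ℕ) : ℝ) * T))
      (γ (((I.equivFin.symm j : ℕ) : ℝ) * T + T)) = T := by
      rw [hd, abs_sub_comm, abs_of_nonneg (by linarith)]; ring
    refine ⟨1, ?_, ?_⟩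
    · rw [one_smul]; linarith
    · rw [one_smul, dist_comm]; linarith

end Helpers2

theorem no_matching_quasimorphism (δ : ℝ) (hδ : 0 ≤ δ) :
    ∃ K ≥ (0 : ℝ), ∃ C₁ > (0 : ℝ),
      ∀ (G : Type u) (Y : Type v) [Group G] [MetricSpace Y] [MulAction G Y],
        (∀ g : G, Isometry (fun y : Y => g • y)) →
        GeodesicSpace Y → GromovHyperbolic Y δ →
        ∀ S : Set G, S.Finite → S⁻¹ = S → Subgroup.closure S = ⊤ →
        ∀ (p : Y) (M : ℝ), 0 < M →
        ∀ (g : G) (γ : ℝ → Y) (N : ℝ), 1 < N → dist p (g • p) = N →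
          GeodesicFromTo γ p (g • p) →
          ¬ WellMatched G K γ N (M * Real.log N) →
          ∃ φ : G → ℝ, QuasimorphismWithDefect φ C₁ ∧
            N / (100 * M * Real.log N) ≤ φ g := by
  set B : ℝ := 10 + 20 * (4 * δ) with hBdef
  have hB : 0 ≤ B := by rw [hBdef]; linarith
  set r : ℝ := 2 + 2 * B with hrdef
  have hr : 0 ≤ r := by linarith
  set c : ℝ := 2 * B + 4 * r + 1 + 2 * r with hcdef
  have hc : 0 ≤ c := by linarith
  refine ⟨100 + 25 * c, by linarith, 12 * B + 8, by linarith, ?_⟩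
  intro G Y _ _ _ hiso hgeo hhyp S _ _ _ p M hM g γ N hN hdist hγ hnot
  set T : ℝ := M * Real.log N with hTdef
  have hT : 0 < T := mul_pos hM (Real.log_pos hN)
  have hγN : IsGeodesicOn γ 0 N := by rw [← hdist]; exact hγ.2.2
  have hTK : 100 + 25 * c < T := by
    by_contra hcon
    exact hnot (wellMatched_small hT (not_lt.1 hcon) hγN)
  simp only [WellMatched, not_forall] at hnot
  obtain ⟨I, hI, hcard, hno⟩ := hnot
  have hp : Pts Y := pts_of_geod hgeo
  have hD : 0 ≤ 4 * δ := by linarith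
  have h4 : Four Y (4 * δ) := four_of_hyp hδ hgeo hhyp
  -- the reward relation
  let R : Y → Y → Prop := fun y z =>
    ∃ h : G, ∃ i ∈ I, y = h • γ ((i : ℝ) * T) ∧ z = h • γ ((i : ℝ) * T + T)
  have hRdist : ∀ u v, R u v → dist u v = T := by
    rintro u v ⟨h, i, hi, rfl, rfl⟩
    have h1 := hI i hi
    have h2 : 0 ≤ (i : ℝ) * T := by positivity
    have h3 := (hiso h).dist_eq (γ ((i : ℝ) * T)) (γ ((i : ℝ) * T + T))
    rw [h3, hγN _ ⟨h2, by linarith⟩ _ ⟨by linarith, by linarith⟩, abs_sub_comm,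
      abs_of_nonneg (by linarith)]
    ring
  have hR : ∀ u v, R u v → 100 ≤ dist u v := by
    intro u v h
    rw [hRdist u v h]
    linarith
  have hinv : ∀ (k : G) u v, R u v → R (k • u) (k • v) := by
    rintro k u v ⟨h, i, hi, rfl, rfl⟩
    exact ⟨k * h, i, hi, by rw [mul_smul], by rw [mul_smul]⟩
  have hF := goodF_chF hR
  have hq : ∀ x y z, dist x y + dist y z ≤ dist x z + 4 * δ →
      chF R x y + chF R y z ≤ chF R x z + B := qadd_all hD hp h4 hF
  -- the upper bound on the forward cost
  have hup : chF R p (g • p) ≤ N - I.card := by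
    have h1 := upper_count hF (by linarith : (0:ℝ) ≤ N) hT hγN I hI (by
      intro i hi
      have h1 : R (γ ((i : ℝ) * T)) (γ ((i : ℝ) * T + T)) :=
        ⟨1, i, hi, by rw [one_smul], by rw [one_smul]⟩
      have h2 := chF_reward hR h1
      rwa [hRdist _ _ h1] at h2)
    have e1 := hγ.1
    have e2 := hγ.2.1
    rw [hdist] at e2
    rwa [e1, e2] at h1
  -- a nearly optimal backward chain
  obtain ⟨k, cost, hch, hcost⟩ := chF_near (R := R) (g • p) p one_pos
  have hlow := hch.lower'
  rw [dist_comm, hdist] at hlow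
  have hk : 19 * (k : ℝ) ≤ 18 * I.card + 40 := by
    obtain ⟨u, v, huv, hvu⟩ := hch.edges hR
    have hposu : ∀ j, ∃ a, j < k → a ∈ Set.Icc (0 : ℝ) (dist p (g • p)) ∧
        dist (γ a) (u j) ≤ r := by
      intro j
      by_cases hj : j < k
      · obtain ⟨a, ha, ha'⟩ := position h4 hF hB hq hγ (u := u j)
          (by linarith [(huv j hj).2, hF.tri (u j) (v j) p])
        exact ⟨a, fun _ => ⟨ha, ha'⟩⟩
      · exact ⟨0, fun h => absurd h hj⟩
    have hposv : ∀ j, ∃ a, j < k → a ∈ Set.Icc (0 : ℝ) (dist p (g • p)) ∧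
        dist (γ a) (v j) ≤ r := by
      intro j
      by_cases hj : j < k
      · obtain ⟨a, ha, ha'⟩ := position h4 hF hB hq hγ (u := v j)
          (by linarith [(huv j hj).2, hF.tri (g • p) (u j) (v j)])
        exact ⟨a, fun _ => ⟨ha, ha'⟩⟩
      · exact ⟨0, fun h => absurd h hj⟩
    choose a ha using hposu
    choose b hb using hposv
    have hab : ∀ j < k, |a j - b j - T| ≤ 2 * r := by
      intro j hj
      obtain ⟨a1, a2⟩ := ha j hj
      obtain ⟨b1, b2⟩ := hb j hj
      have nb := no_back hD hF hB hq hγ a1 b1 a2 b2 (by linarith [(huv j hj).2])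
      have hd := hRdist _ _ (huv j hj).1
      have hd' := hγ.2.2 (a j) a1 (b j) b1
      have t1 := dist_triangle4 (γ (a j)) (u j) (v j) (γ (b j))
      have t2 := dist_triangle4 (u j) (γ (a j)) (γ (b j)) (v j)
      have c1 := dist_comm (u j) (γ (a j))
      have c2 := dist_comm (v j) (γ (b j))
      rcases abs_cases (a j - b j) with ⟨h1, h2⟩ | ⟨h1, h2⟩
      · rw [abs_le]; constructor <;> linarith
      · exfalso; linarith
    have hba : ∀ j j', j < j' → j' < k → b j' + T - c ≤ b j := by
      intro j j' hj hj'
      obtain ⟨a1, a2⟩ := ha j' hj'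
      obtain ⟨b1, b2⟩ := hb j (by omega)
      have nb := no_back hD hF hB hq hγ b1 a1 b2 a2 (by linarith [hvu j j' hj hj'])
      have := abs_le.1 (hab j' hj')
      linarith [this.1]
    have hb0 : ∀ j < k, 0 ≤ b j ∧ b j + T ≤ N + c := by
      intro j hj
      have h1 := (hb j hj).1.1
      have h2 := (ha j hj).1.2
      have := abs_le.1 (hab j hj)
      exact ⟨h1, by linarith [this.1]⟩
    obtain ⟨J, β, hJk, hJcard, hJ0, hJd, hJb⟩ := spread hc (by linarith) hb0 hba
    by_contra hcon
    apply hno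
    have hJcard' : 19 * (k : ℝ) ≤ 20 * J.card + 40 := by exact_mod_cast hJcard
    have hsel : ∀ j, ∃ i, j ∈ J → i ∈ I ∧ Matched G (100 + 25 * c) γ ((i : ℝ) * T) (β j) T := by
      intro j
      by_cases hj : j ∈ J
      · have hjk := hJk j hj
        obtain ⟨h, i, hi, hu, hv⟩ := (huv j hjk).1
        refine ⟨i, fun _ => ⟨hi, h, ?_, ?_⟩⟩
        · rw [← hu]
          obtain ⟨a1, a2⟩ := ha j hjk
          have hd := hγN (a j) (by rw [← hdist]; exact a1) (β j + T)
            ⟨by linarith [(hJ0 j hj).1], (hJ0 j hj).2⟩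
          have h1 := abs_le.1 (hab j hjk)
          have h2 := hJb j
          have h3 : |a j - (β j + T)| ≤ 2 * r + 20 * c := by
            rw [abs_le]; constructor <;> linarith [h1.1, h1.2, h2.1, h2.2]
          have t := dist_triangle (u j) (γ (a j)) (γ (β j + T))
          rw [dist_comm (u j) (γ (a j))] at t
          linarith
        · rw [← hv]
          obtain ⟨a1, a2⟩ := hb j hjk
          have hd := hγN (b j) (by rw [← hdist]; exact a1) (β j)
            ⟨(hJ0 j hj).1, by linarith [(hJ0 j hj).2]⟩
          have h2 := hJb j
          have h3 : |b j - β j| ≤ 20 * c := by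
            rw [abs_le]; constructor <;> linarith [h2.1, h2.2]
          have t := dist_triangle (v j) (γ (b j)) (γ (β j))
          rw [dist_comm (v j) (γ (b j))] at t
          linarith
      · exact ⟨0, fun h => absurd h hj⟩
    choose idx hidx using hsel
    refine ⟨J.card, by linarith, fun m => β (J.equivFin.symm m), fun m => idx (J.equivFin.symm m),
      fun m => (hidx _ (J.equivFin.symm m).2).1, fun m => hJ0 _ (J.equivFin.symm m).2, ?_,
      fun m => (hidx _ (J.equivFin.symm m).2).2⟩
    intro m m' hne
    refine hJd _ (J.equivFin.symm m).2 _ (J.equivFin.symm m').2 ?_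
    intro h
    exact hne (J.equivFin.symm.injective (Subtype.ext h))
  -- the quasimorphism
  refine ⟨fun f => 2 * (chF R (f • p) p - chF R p (f • p)) + 8, ?_, ?_⟩
  · intro x y
    have h := defect_bound hD hp h4 hF hq p (x • p) ((x * y) • p)
    rw [mul_smul, chF_smul hiso hinv x (y • p) p, chF_smul hiso hinv x p (y • p)] at h
    rw [abs_le] at h
    simp only [mul_smul]
    rw [abs_le]
    constructor <;> linarith [h.1, h.2]
  · have e1 : N / (100 * M * Real.log N) = N / (10 * T) / 10 := by
      rw [hTdef, div_div]
      congr 1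
      ring
    rw [e1]
    simp only
    linarith

end SclPaper
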